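/- Let I ⊆ [0,1] be an interval, 𝒫 a finite partition of I into intervals, 2 ≤ p < ∞, R > 0, and C₀ ≥ 0. Suppose that ‖E_I g‖_{L^p(B)} ≤ C₀ (Σ_{J ∈ 𝒫} ‖E_J g‖_{L^p(w_B)}²)^{1/2} holds for every integrable g : [0,1] → ℂ and every axis-parallel square B of side length R. Then there is an absolute constant c (independent of I, 𝒫, p, R, C₀) such that ‖E_I g‖_{L^p(w_B)} ≤ c · C₀ (Σ_{J ∈ 𝒫} ‖E_J g‖_{L^p(w_B)}²)^{1/2} for every integrable g : [0,1] → ℂ and every axis-parallel square B of side length R. The same implication holds with w_B replaced by the product weight w̃_B throughout. -/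

import Mathlib

open MeasureTheory

noncomputable section

/-- The weight `w_B` attached to the axis-parallel square of center `c` and side length `R`:
`w_B(x) = (1 + |x - c|/R)^(-100)` with `|·|` the Euclidean norm on `ℝ²`. -/
def wB (c : ℝ × ℝ) (R : ℝ) (x : ℝ × ℝ) : ℝ :=
  (1 + Real.sqrt ((x.1 - c.1) ^ 2 + (x.2 - c.2) ^ 2) / R) ^ (-100 : ℤ)

/-- The product weight `w̃_B(x) = (1 + |x₁ - c₁|/R)^(-100) * (1 + |x₂ - c₂|/R)^(-100)`. -/
def wtB (c : ℝ × ℝ) (R : ℝ) (x : ℝ × ℝ) : ℝ :=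
  (1 + |x.1 - c.1| / R) ^ (-100 : ℤ) * (1 + |x.2 - c.2| / R) ^ (-100 : ℤ)

/-- The axis-parallel square `B(c, R)` with center `c` and side length `R`, as a subset of `ℝ²`. -/
def sqr (c : ℝ × ℝ) (R : ℝ) : Set (ℝ × ℝ) :=
  Set.Icc (c.1 - R / 2) (c.1 + R / 2) ×ˢ Set.Icc (c.2 - R / 2) (c.2 + R / 2)

/-- The extension operator associated to the parabola, over the interval `[a, b]`:
`(E_{[a,b]} g)(x) = ∫_{[a,b]} g(ξ) e(ξ x₁ + ξ² x₂) dξ`. -/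
def extOp (a b : ℝ) (g : ℝ → ℂ) (x : ℝ × ℝ) : ℂ :=
  ∫ ξ in Set.Icc a b,
    g ξ * Complex.exp (2 * Real.pi * Complex.I * ((ξ * x.1 + ξ ^ 2 * x.2 : ℝ) : ℂ))

/-- Weighted `L^p` norm `‖f‖_{L^p(w)} = (∫_{ℝ²} |f|^p w)^{1/p}`. -/
def wLp (p : ℝ) (w : ℝ × ℝ → ℝ) (f : ℝ × ℝ → ℂ) : ℝ :=
  (∫ x : ℝ × ℝ, ‖f x‖ ^ p * w x) ^ (1 / p)

/-- `L^p` norm over the square of center `c` and side `R`. -/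
def sqLp (p : ℝ) (c : ℝ × ℝ) (R : ℝ) (f : ℝ × ℝ → ℂ) : ℝ :=
  (∫ x in sqr c R, ‖f x‖ ^ p) ^ (1 / p)

/-- Normalized weighted `L^p` norm `‖f‖_{L^p_#(w)} = (|B|⁻¹ ∫_{ℝ²} |f|^p w)^{1/p}` where the
normalizing square has side length `R` (so `|B| = R²`). -/
def shLp (p R : ℝ) (w : ℝ × ℝ → ℝ) (f : ℝ × ℝ → ℂ) : ℝ :=
  ((R ^ 2)⁻¹ * ∫ x : ℝ × ℝ, ‖f x‖ ^ p * w x) ^ (1 / p)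

/-- Normalized `L^p` norm over the square of center `c` and side `R`:
`‖f‖_{L^p_#(B)} = (|B|⁻¹ ∫_B |f|^p)^{1/p}`. -/
def shLpSq (p : ℝ) (c : ℝ × ℝ) (R : ℝ) (f : ℝ × ℝ → ℂ) : ℝ :=
  ((R ^ 2)⁻¹ * ∫ x in sqr c R, ‖f x‖ ^ p) ^ (1 / p)

/-- `DecIneq p n D` says that the constant `D` is admissible in the `l²L^p` decoupling
inequality for the parabola at scale `δ = 1/n`: for every integrable `g : [0,1] → ℂ` and every
axis-parallel square `B` of side length `δ⁻² = n²`,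
`‖E_{[0,1]} g‖_{L^p(B)} ≤ D (Σ_{J ∈ P_δ([0,1])} ‖E_J g‖_{L^p(w_B)}²)^{1/2}`. -/
def DecIneq (p : ℝ) (n : ℕ) (D : ℝ) : Prop :=
  ∀ g : ℝ → ℂ, IntegrableOn g (Set.Icc 0 1) → ∀ c : ℝ × ℝ,
    sqLp p c ((n : ℝ) ^ 2) (extOp 0 1 g) ≤
      D * (∑ k ∈ Finset.range n,
        wLp p (wB c ((n : ℝ) ^ 2)) (extOp ((k : ℝ) / (n : ℝ)) (((k : ℝ) + 1) / (n : ℝ)) g) ^ 2)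
        ^ (1 / 2 : ℝ)

/-- The decoupling constant `D_p(δ)` for the parabola at scale `δ = 1/n`, i.e. the smallest
admissible constant in the decoupling inequality. -/
def Dconst (p : ℝ) (n : ℕ) : ℝ := sInf {D : ℝ | 0 ≤ D ∧ DecIneq p n D}

/-- Center of the `(i,j)` square in the partition of the axis-parallel square of center `c` and
side length `Rb` into axis-parallel squares of side length `r`. -/
def subCtr (c : ℝ × ℝ) (Rb r : ℝ) (i j : ℕ) : ℝ × ℝ :=
  (c.1 - Rb / 2 + ((i : ℝ) + 1 / 2) * r, c.2 - Rb / 2 + ((j : ℝ) + 1 / 2) * r)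

/-- `BilIneq p n k b M` says `M` is admissible in the bilinear decoupling inequality with
`δ = 1/n`, `ν = 1/k`: for every square `B` of side `δ⁻² = n²`, every integrable `g`, and all
`ν`-separated intervals `I = [i/k, (i+1)/k]`, `I' = [i'/k, (i'+1)/k]` of the partition
`P_ν([0,1])`,
`Avg_{Δ ∈ P_{ν^{-b}}(B)} Π (Σ_{J ∈ P_{ν^b}} ‖E_J g‖_{L²_#(w̃_Δ)}²)^{p/4}
  ≤ M^p Π (Σ_{J ∈ P_δ} ‖E_J g‖_{L^p_#(w_B)}²)^{p/4}`. -/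
def BilIneq (p : ℝ) (n k b : ℕ) (M : ℝ) : Prop :=
  ∀ g : ℝ → ℂ, IntegrableOn g (Set.Icc 0 1) → ∀ c : ℝ × ℝ,
    ∀ i i' : ℕ, i < k → i' < k → (i + 1 < i' ∨ i' + 1 < i) →
    (((n ^ 2 / k ^ b : ℕ) : ℝ) ^ 2)⁻¹ *
        ∑ a ∈ Finset.range (n ^ 2 / k ^ b), ∑ a' ∈ Finset.range (n ^ 2 / k ^ b),
          ((∑ J ∈ Finset.range (k ^ (b - 1)),
              shLp 2 ((k : ℝ) ^ b)
                (wtB (subCtr c ((n : ℝ) ^ 2) ((k : ℝ) ^ b) a a') ((k : ℝ) ^ b))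
                (extOp ((i : ℝ) / (k : ℝ) + (J : ℝ) / (k : ℝ) ^ b)
                  ((i : ℝ) / (k : ℝ) + ((J : ℝ) + 1) / (k : ℝ) ^ b) g) ^ 2) ^ (p / 4) *
            (∑ J ∈ Finset.range (k ^ (b - 1)),
              shLp 2 ((k : ℝ) ^ b)
                (wtB (subCtr c ((n : ℝ) ^ 2) ((k : ℝ) ^ b) a a') ((k : ℝ) ^ b))
                (extOp ((i' : ℝ) / (k : ℝ) + (J : ℝ) / (k : ℝ) ^ b)
                  ((i' : ℝ) / (k : ℝ) + ((J : ℝ) + 1) / (k : ℝ) ^ b) g) ^ 2) ^ (p / 4))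
      ≤ M ^ p *
        ((∑ J ∈ Finset.range (n / k),
            shLp p ((n : ℝ) ^ 2) (wB c ((n : ℝ) ^ 2))
              (extOp ((i : ℝ) / (k : ℝ) + (J : ℝ) / (n : ℝ))
                ((i : ℝ) / (k : ℝ) + ((J : ℝ) + 1) / (n : ℝ)) g) ^ 2) ^ (p / 4) *
          (∑ J ∈ Finset.range (n / k),
            shLp p ((n : ℝ) ^ 2) (wB c ((n : ℝ) ^ 2))
              (extOp ((i' : ℝ) / (k : ℝ) + (J : ℝ) / (n : ℝ))
                ((i' : ℝ) / (k : ℝ) + ((J : ℝ) + 1) / (n : ℝ)) g) ^ 2) ^ (p / 4))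

/-- The bilinear decoupling constant `M_{p,b}(δ, ν)` with `δ = 1/n`, `ν = 1/k`. -/
def Mconst (p : ℝ) (n k b : ℕ) : ℝ := sInf {M : ℝ | 0 ≤ M ∧ BilIneq p n k b M}

/-- The Fourier transform of a function on `ℝ²`. -/
def ftR2 (η : ℝ × ℝ → ℝ) (ξ : ℝ × ℝ) : ℂ :=
  ∫ x : ℝ × ℝ, (η x : ℂ) * Complex.exp (-(2 * Real.pi * Complex.I) * ((x.1 * ξ.1 + x.2 * ξ.2 : ℝ) : ℂ))

end

section Kernel

/-- The Poisson-type profile `t ↦ (1 + ((s - t) / R)²)⁻¹` dominating the weights in one variable. -/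
noncomputable def cauchyProfile (R s t : ℝ) : ℝ := (1 + ((t - s) / R) ^ 2)⁻¹

lemma cauchyProfile_nonneg (R s t : ℝ) : 0 ≤ cauchyProfile R s t := by
  unfold cauchyProfile; positivity

lemma integrable_cauchyProfile {R : ℝ} (hR : 0 < R) (s : ℝ) :
    Integrable (cauchyProfile R s) :=
  (integrable_inv_one_add_sq.comp_div hR.ne').comp_sub_right s

lemma integral_cauchyProfile {R : ℝ} (hR : 0 < R) (s : ℝ) :
    ∫ t, cauchyProfile R s t = R * Real.pi := by
  unfold cauchyProfile
  rw [integral_sub_right_eq_self (fun t => (1 + (t / R) ^ 2)⁻¹) s,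
    Measure.integral_comp_div (fun t => (1 + t ^ 2)⁻¹) R, integral_univ_inv_one_add_sq,
    abs_of_pos hR, smul_eq_mul]

lemma integrable_cauchyProfile_prod {R : ℝ} (hR : 0 < R) (c x : ℝ × ℝ) :
    Integrable fun y : ℝ × ℝ => (cauchyProfile R c.1 y.1 + cauchyProfile R x.1 y.1) *
      (cauchyProfile R c.2 y.2 + cauchyProfile R x.2 y.2) :=
  ((integrable_cauchyProfile hR c.1).add (integrable_cauchyProfile hR x.1)).mul_prod
    ((integrable_cauchyProfile hR c.2).add (integrable_cauchyProfile hR x.2))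

lemma integral_cauchyProfile_prod {R : ℝ} (hR : 0 < R) (c x : ℝ × ℝ) :
    ∫ y : ℝ × ℝ, (cauchyProfile R c.1 y.1 + cauchyProfile R x.1 y.1) *
      (cauchyProfile R c.2 y.2 + cauchyProfile R x.2 y.2) = 4 * Real.pi ^ 2 * R ^ 2 := by
  have h (s s' : ℝ) : ∫ t, (cauchyProfile R s t + cauchyProfile R s' t) = 2 * R * Real.pi := by
    rw [integral_add (integrable_cauchyProfile hR s) (integrable_cauchyProfile hR s'),
      integral_cauchyProfile hR, integral_cauchyProfile hR]
    ring
  rw [Measure.volume_eq_prod, integral_prod_mul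
    (fun t => cauchyProfile R c.1 t + cauchyProfile R x.1 t)
    (fun t => cauchyProfile R c.2 t + cauchyProfile R x.2 t), h, h]
  ring

lemma one_add_zpow_le {a b : ℝ} (ha : 0 ≤ a) (hab : 1 + b ≤ 2 * (1 + a)) (hb : 0 ≤ b) :
    (1 + a) ^ (-100 : ℤ) ≤ 2 ^ 100 * (1 + b) ^ (-100 : ℤ) := by
  rw [zpow_neg, zpow_neg, zpow_ofNat, zpow_ofNat]
  have h : (1 + b) ^ 100 ≤ (2 * (1 + a)) ^ 100 := pow_le_pow_left₀ (by positivity) hab _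
  rw [mul_pow] at h
  rw [← div_eq_mul_inv, inv_eq_one_div, div_le_div_iff₀ (by positivity) (by positivity)]
  linarith

lemma one_add_zpow_mul_le {a b d : ℝ} (ha : 0 ≤ a) (hb : 0 ≤ b) (hd : 0 ≤ d) (h : d ≤ a + b) :
    (1 + a) ^ (-100 : ℤ) * (1 + b) ^ (-100 : ℤ) ≤
      2 ^ 100 * (1 + d) ^ (-100 : ℤ) * ((1 + a) ^ (-100 : ℤ) + (1 + b) ^ (-100 : ℤ)) := by
  have hA : 0 ≤ (1 + a) ^ (-100 : ℤ) := by positivity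
  have hB : 0 ≤ (1 + b) ^ (-100 : ℤ) := by positivity
  have hD : 0 ≤ 2 ^ 100 * (1 + d) ^ (-100 : ℤ) := by positivity
  rcases le_total a b with hab | hab
  · have := mul_le_mul_of_nonneg_left (one_add_zpow_le hb (b := d) (by linarith) hd) hA
    have := mul_nonneg hD hB
    linarith
  · have := mul_le_mul_of_nonneg_right (one_add_zpow_le ha (b := d) (by linarith) hd) hB
    have := mul_nonneg hD hA
    linarith

lemma one_add_zpow_le_inv {a s : ℝ} (ha : 0 ≤ a) (hs : 0 < s) (h : s ≤ (1 + a) ^ 4) :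
    (1 + a) ^ (-100 : ℤ) ≤ s⁻¹ := by
  rw [zpow_neg, zpow_ofNat]
  exact inv_anti₀ hs (h.trans (pow_le_pow_right₀ (by linarith) (by norm_num)))

lemma one_add_abs_zpow_le_cauchyProfile {R : ℝ} (hR : 0 < R) (s t : ℝ) :
    (1 + |t - s| / R) ^ (-100 : ℤ) ≤ cauchyProfile R s t := by
  have ha : 0 ≤ |t - s| / R := by positivity
  have : ((t - s) / R) ^ 2 = (|t - s| / R) ^ 2 := by rw [div_pow, div_pow, sq_abs]
  refine one_add_zpow_le_inv ha (by positivity) ?_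
  rw [this]
  nlinarith [pow_nonneg ha 2, pow_nonneg ha 3, pow_nonneg ha 4]

end Kernel

section Weights

lemma sqrt_sq_add_sq_eq_norm (a b : ℝ) : √(a ^ 2 + b ^ 2) = ‖(a + b * Complex.I : ℂ)‖ :=
  (Complex.norm_add_mul_I a b).symm

lemma sqrt_dist_triangle (c y x : ℝ × ℝ) :
    √((x.1 - c.1) ^ 2 + (x.2 - c.2) ^ 2) ≤
      √((y.1 - c.1) ^ 2 + (y.2 - c.2) ^ 2) + √((x.1 - y.1) ^ 2 + (x.2 - y.2) ^ 2) := by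
  simp only [sqrt_sq_add_sq_eq_norm]
  refine le_of_eq_of_le (congrArg _ ?_) (norm_add_le _ _)
  push_cast
  ring

lemma wB_nonneg {R : ℝ} (hR : 0 < R) (c x : ℝ × ℝ) : 0 ≤ wB c R x := by
  unfold wB; positivity

lemma wtB_nonneg {R : ℝ} (hR : 0 < R) (c x : ℝ × ℝ) : 0 ≤ wtB c R x := by
  unfold wtB; positivity

lemma measurable_wB (R : ℝ) : Measurable fun q : (ℝ × ℝ) × ℝ × ℝ => wB q.1 R q.2 := by
  unfold wB
  simp only [zpow_neg, zpow_ofNat]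
  fun_prop

lemma measurable_wtB (R : ℝ) : Measurable fun q : (ℝ × ℝ) × ℝ × ℝ => wtB q.1 R q.2 := by
  unfold wtB
  simp only [zpow_neg, zpow_ofNat, ← Real.norm_eq_abs]
  fun_prop

lemma mem_sqr_iff {c x : ℝ × ℝ} {R : ℝ} :
    x ∈ sqr c R ↔ |x.1 - c.1| ≤ R / 2 ∧ |x.2 - c.2| ≤ R / 2 := by
  simp only [sqr, Set.mem_prod, Set.mem_Icc, abs_le]
  constructor <;> rintro ⟨⟨_, _⟩, _, _⟩ <;> refine ⟨⟨?_, ?_⟩, ?_, ?_⟩ <;> linarith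

lemma wB_le_of_mem_sqr {R : ℝ} (hR : 0 < R) {c x y : ℝ × ℝ} (h : x ∈ sqr y R) :
    wB c R x ≤ 2 ^ 200 * wB c R y := by
  obtain ⟨h1, h2⟩ := mem_sqr_iff.1 h
  have hxy : √((y.1 - x.1) ^ 2 + (y.2 - x.2) ^ 2) ≤ R := by
    rw [Real.sqrt_le_left hR.le]
    have := sq_le_sq' (by linarith [abs_le.1 h1]) (abs_le.1 h1).2
    have := sq_le_sq' (by linarith [abs_le.1 h2]) (abs_le.1 h2).2
    nlinarith
  have htri := sqrt_dist_triangle c x y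
  have hle : √((y.1 - c.1) ^ 2 + (y.2 - c.2) ^ 2) / R ≤
      √((x.1 - c.1) ^ 2 + (x.2 - c.2) ^ 2) / R + 1 := by
    rw [div_add_one hR.ne']
    gcongr
    linarith
  have hx : 0 ≤ √((x.1 - c.1) ^ 2 + (x.2 - c.2) ^ 2) / R := by positivity
  have h := one_add_zpow_le hx (b := √((y.1 - c.1) ^ 2 + (y.2 - c.2) ^ 2) / R)
    (by linarith) (by positivity)
  refine h.trans (mul_le_mul_of_nonneg_right (by norm_num) (wB_nonneg hR c y))

lemma wtB_le_of_mem_sqr {R : ℝ} (hR : 0 < R) {c x y : ℝ × ℝ} (h : x ∈ sqr y R) :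
    wtB c R x ≤ 2 ^ 200 * wtB c R y := by
  have key {a b d : ℝ} (h : |a - b| ≤ R / 2) :
      (1 + |a - d| / R) ^ (-100 : ℤ) ≤ 2 ^ 100 * (1 + |b - d| / R) ^ (-100 : ℤ) := by
    have hle : |b - d| / R ≤ |a - d| / R + 1 := by
      rw [div_add_one hR.ne']
      gcongr
      have := abs_sub_le b a d
      rw [abs_sub_comm b a] at this
      linarith
    have : 0 ≤ |a - d| / R := by positivity
    exact one_add_zpow_le this (by linarith) (by positivity)
  obtain ⟨h1, h2⟩ := mem_sqr_iff.1 h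
  have := mul_le_mul (key (d := c.1) h1) (key (d := c.2) h2) (by positivity) (by positivity)
  unfold wtB
  linarith

lemma wB_le_cauchyProfile {R : ℝ} (hR : 0 < R) (c x : ℝ × ℝ) :
    wB c R x ≤ cauchyProfile R c.1 x.1 * cauchyProfile R c.2 x.2 := by
  have hr : 0 ≤ √((x.1 - c.1) ^ 2 + (x.2 - c.2) ^ 2) / R := by positivity
  have hsq : (√((x.1 - c.1) ^ 2 + (x.2 - c.2) ^ 2) / R) ^ 2 =
      ((x.1 - c.1) / R) ^ 2 + ((x.2 - c.2) / R) ^ 2 := by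
    rw [div_pow, Real.sq_sqrt (by positivity)]
    ring
  unfold cauchyProfile wB
  rw [← mul_inv]
  refine one_add_zpow_le_inv hr (by positivity) ?_
  set r := √((x.1 - c.1) ^ 2 + (x.2 - c.2) ^ 2) / R
  calc (1 + ((x.1 - c.1) / R) ^ 2) * (1 + ((x.2 - c.2) / R) ^ 2)
      ≤ (1 + r ^ 2) * (1 + r ^ 2) := by
        rw [hsq]
        gcongr <;> nlinarith [sq_nonneg ((x.1 - c.1) / R), sq_nonneg ((x.2 - c.2) / R)]
    _ ≤ (1 + r) ^ 2 * (1 + r) ^ 2 := by gcongr <;> nlinarith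
    _ = (1 + r) ^ 4 := by ring

lemma wtB_le_cauchyProfile {R : ℝ} (hR : 0 < R) (c x : ℝ × ℝ) :
    wtB c R x ≤ cauchyProfile R c.1 x.1 * cauchyProfile R c.2 x.2 :=
  mul_le_mul (one_add_abs_zpow_le_cauchyProfile hR _ _) (one_add_abs_zpow_le_cauchyProfile hR _ _)
    (by positivity) (cauchyProfile_nonneg _ _ _)

lemma cauchyProfile_comm (R s t : ℝ) : cauchyProfile R s t = cauchyProfile R t s := by
  unfold cauchyProfile
  rw [← neg_sub s t, neg_div, neg_sq]

lemma wB_mul_wB_le {R : ℝ} (hR : 0 < R) (c y x : ℝ × ℝ) :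
    wB c R y * wB y R x ≤ 2 ^ 200 * wB c R x *
      ((cauchyProfile R c.1 y.1 + cauchyProfile R x.1 y.1) *
        (cauchyProfile R c.2 y.2 + cauchyProfile R x.2 y.2)) := by
  have htri : √((x.1 - c.1) ^ 2 + (x.2 - c.2) ^ 2) / R ≤
      √((y.1 - c.1) ^ 2 + (y.2 - c.2) ^ 2) / R + √((x.1 - y.1) ^ 2 + (x.2 - y.2) ^ 2) / R := by
    rw [← add_div]
    gcongr
    exact sqrt_dist_triangle c y x
  refine (one_add_zpow_mul_le (by positivity) (by positivity) (by positivity) htri).trans ?_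
  refine mul_le_mul (mul_le_mul_of_nonneg_right (by norm_num) (by positivity)) ?_
    (by positivity) (mul_nonneg (by norm_num) (wB_nonneg hR c x))
  have h1 := wB_le_cauchyProfile hR c y
  have h2 := wB_le_cauchyProfile hR y x
  rw [cauchyProfile_comm R y.1, cauchyProfile_comm R y.2] at h2
  have h3 := mul_nonneg (cauchyProfile_nonneg R c.1 y.1) (cauchyProfile_nonneg R x.2 y.2)
  have h4 := mul_nonneg (cauchyProfile_nonneg R x.1 y.1) (cauchyProfile_nonneg R c.2 y.2)
  unfold wB at h1 h2
  linarith

lemma wtB_mul_wtB_le {R : ℝ} (hR : 0 < R) (c y x : ℝ × ℝ) :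
    wtB c R y * wtB y R x ≤ 2 ^ 200 * wtB c R x *
      ((cauchyProfile R c.1 y.1 + cauchyProfile R x.1 y.1) *
        (cauchyProfile R c.2 y.2 + cauchyProfile R x.2 y.2)) := by
  have key (a b d : ℝ) : (1 + |b - a| / R) ^ (-100 : ℤ) * (1 + |d - b| / R) ^ (-100 : ℤ) ≤
      2 ^ 100 * (1 + |d - a| / R) ^ (-100 : ℤ) *
        (cauchyProfile R a b + cauchyProfile R d b) := by
    have htri : |d - a| / R ≤ |b - a| / R + |d - b| / R := by
      rw [← add_div]
      gcongr
      linarith [abs_sub_le d b a]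
    refine (one_add_zpow_mul_le (by positivity) (by positivity) (by positivity) htri).trans ?_
    rw [cauchyProfile_comm R d b]
    gcongr
    · exact one_add_abs_zpow_le_cauchyProfile hR _ _
    · exact one_add_abs_zpow_le_cauchyProfile hR _ _
  have h := mul_le_mul (key c.1 y.1 x.1) (key c.2 y.2 x.2) (by positivity)
    ((by positivity : (0 : ℝ) ≤ _ * _).trans (key c.1 y.1 x.1))
  unfold wtB
  linarith

end Weights

section Averaging

open ENNReal

lemma lintegral_finset_sum_rpow_le {α ι : Type*} [MeasurableSpace α] {μ : Measure α}
    (s : Finset ι) {f : ι → α → ℝ≥0∞} (hf : ∀ i ∈ s, Measurable (f i)) {q : ℝ} (hq : 1 ≤ q) :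
    (∫⁻ a, (∑ i ∈ s, f i a) ^ q ∂μ) ^ (1 / q) ≤ ∑ i ∈ s, (∫⁻ a, f i a ^ q ∂μ) ^ (1 / q) := by
  classical
  have hq0 : 0 < q := by linarith
  induction s using Finset.induction_on with
  | empty => simp [hq0]
  | insert i s hi ih =>
    simp only [Finset.sum_insert hi]
    have hs : ∀ j ∈ s, Measurable (f j) := fun j hj => hf j (Finset.mem_insert_of_mem hj)
    have h := lintegral_Lp_add_le (μ := μ) (hf i (Finset.mem_insert_self i s)).aemeasurable
      (Finset.measurable_fun_sum s hs).aemeasurable hq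
    exact h.trans (by gcongr; exact ih hs)

lemma sqr_comm {x y : ℝ × ℝ} {R : ℝ} : x ∈ sqr y R ↔ y ∈ sqr x R := by
  simp only [mem_sqr_iff, abs_sub_comm]

lemma measurableSet_sqr (c : ℝ × ℝ) (R : ℝ) : MeasurableSet (sqr c R) :=
  measurableSet_Icc.prod measurableSet_Icc

lemma volume_sqr (c : ℝ × ℝ) {R : ℝ} (hR : 0 < R) :
    volume (sqr c R) = ENNReal.ofReal (R ^ 2) := by
  rw [sqr, Measure.volume_eq_prod, Measure.prod_prod, Real.volume_Icc, Real.volume_Icc,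
    ← ENNReal.ofReal_mul (by linarith)]
  congr 1
  ring

lemma measurableSet_sqr_graph (R : ℝ) :
    MeasurableSet {q : (ℝ × ℝ) × ℝ × ℝ | q.1 ∈ sqr q.2 R} := by
  simp only [mem_sqr_iff, ← Real.norm_eq_abs, Set.ofPred_and]
  exact (measurableSet_le (by fun_prop) (by fun_prop)).inter
    (measurableSet_le (by fun_prop) (by fun_prop))

/-- A weighted integral is controlled by the weighted average of integrals over squares. -/
lemma lintegral_mul_weight_le_average {w : ℝ × ℝ → ℝ≥0∞} (hw : Measurable w) {R : ℝ} (hR : 0 < R)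
    {K : ℝ≥0∞} (hwK : ∀ x y, x ∈ sqr y R → w x ≤ K * w y)
    {G : ℝ × ℝ → ℝ≥0∞} (hG : Measurable G) :
    ENNReal.ofReal (R ^ 2) * ∫⁻ x, G x * w x ≤ K * ∫⁻ y, w y * ∫⁻ x in sqr y R, G x := by
  have hmeas : Measurable (Function.uncurry fun x y : ℝ × ℝ =>
      {q : (ℝ × ℝ) × ℝ × ℝ | q.1 ∈ sqr q.2 R}.indicator (fun q => K * w q.2 * G q.1) (x, y)) := by
    refine Measurable.indicator ?_ (measurableSet_sqr_graph R)
    fun_prop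
  calc ENNReal.ofReal (R ^ 2) * ∫⁻ x, G x * w x
      = ∫⁻ x, ∫⁻ _ in sqr x R, G x * w x := by
        rw [← lintegral_const_mul _ (by fun_prop)]
        refine lintegral_congr fun x => ?_
        rw [setLIntegral_const, volume_sqr x hR, mul_comm]
    _ ≤ ∫⁻ x, ∫⁻ y in sqr x R, K * w y * G x := by
        refine lintegral_mono fun x => setLIntegral_mono' (measurableSet_sqr x R) fun y hy => ?_
        rw [mul_comm (G x)]
        gcongr
        exact hwK x y (sqr_comm.1 hy)
    _ = ∫⁻ x, ∫⁻ y,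
          {q : (ℝ × ℝ) × ℝ × ℝ | q.1 ∈ sqr q.2 R}.indicator (fun q => K * w q.2 * G q.1) (x, y) := by
        refine lintegral_congr fun x => ?_
        rw [← lintegral_indicator (measurableSet_sqr x R)]
        refine lintegral_congr fun y => ?_
        exact Set.indicator_eq_indicator sqr_comm rfl
    _ = ∫⁻ y, ∫⁻ x,
          {q : (ℝ × ℝ) × ℝ × ℝ | q.1 ∈ sqr q.2 R}.indicator (fun q => K * w q.2 * G q.1) (x, y) :=
        lintegral_lintegral_swap hmeas.aemeasurable
    _ = ∫⁻ y, K * (w y * ∫⁻ x in sqr y R, G x) := by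
        refine lintegral_congr fun y => ?_
        rw [← mul_assoc, ← lintegral_const_mul _ hG, ← lintegral_indicator (measurableSet_sqr y R)]
        rfl
    _ = K * ∫⁻ y, w y * ∫⁻ x in sqr y R, G x := by
        have : Measurable fun y => ∫⁻ x in sqr y R, G x := by
          have h : Measurable fun y => ∫⁻ x,
              {q : (ℝ × ℝ) × ℝ × ℝ | q.1 ∈ sqr q.2 R}.indicator (fun q => G q.1) (x, y) :=
            Measurable.lintegral_prod_left'
              ((hG.comp measurable_fst).indicator (measurableSet_sqr_graph R))
          convert h using 2 with y
          rw [← lintegral_indicator (measurableSet_sqr y R)]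
          rfl
        exact lintegral_const_mul _ (hw.mul this)

/-- Local `L^p` square function bounds on all squares of a given size average, by Minkowski's
inequality, to weighted ones. -/
lemma lintegral_mul_weight_le_of_setLIntegral_sqr_le {ι : Type*} (s : Finset ι)
    {w : ℝ × ℝ → ℝ × ℝ → ℝ≥0∞} (hw : Measurable (Function.uncurry w)) {R : ℝ} (hR : 0 < R)
    {K L : ℝ≥0∞} (hwK : ∀ c x y, x ∈ sqr y R → w c x ≤ K * w c y)
    (hwL : ∀ c x, ∫⁻ y, w c y * w y x ≤ L * ENNReal.ofReal (R ^ 2) * w c x)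
    {G : ℝ × ℝ → ℝ≥0∞} (hG : Measurable G) {F : ι → ℝ × ℝ → ℝ≥0∞} (hF : ∀ k, Measurable (F k))
    {q : ℝ} (hq : 1 ≤ q) {D : ℝ≥0∞}
    (h : ∀ y, ∫⁻ x in sqr y R, G x ≤ D * (∑ k ∈ s, (∫⁻ x, F k x * w y x) ^ (1 / q)) ^ q)
    (c : ℝ × ℝ) :
    ∫⁻ x, G x * w c x ≤ K * L * D * (∑ k ∈ s, (∫⁻ x, F k x * w c x) ^ (1 / q)) ^ q := by
  have hq0 : 0 < q := by linarith
  have hwc (c) : Measurable (w c) := hw.of_uncurry_left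
  have hA (k) : Measurable fun y => ∫⁻ x, F k x * w y x :=
    Measurable.lintegral_prod_right' (f := fun z : (ℝ × ℝ) × ℝ × ℝ => F k z.2 * w z.1 z.2)
      (((hF k).comp measurable_snd).mul hw)
  have hconv (k) : ∫⁻ y, w c y * ∫⁻ x, F k x * w y x ≤
      L * ENNReal.ofReal (R ^ 2) * ∫⁻ x, F k x * w c x := by
    calc ∫⁻ y, w c y * ∫⁻ x, F k x * w y x
        = ∫⁻ y, ∫⁻ x, w c y * (F k x * w y x) :=
          lintegral_congr fun y => (lintegral_const_mul _ ((hF k).mul (hwc y))).symm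
      _ = ∫⁻ x, ∫⁻ y, w c y * (F k x * w y x) :=
          lintegral_lintegral_swap (((hwc c).comp measurable_fst).mul
            (((hF k).comp measurable_snd).mul hw)).aemeasurable
      _ = ∫⁻ x, F k x * ∫⁻ y, w c y * w y x := by
          refine lintegral_congr fun x => ?_
          have hwx : Measurable fun y => w y x := hw.of_uncurry_right
          rw [← lintegral_const_mul _ (by fun_prop)]
          exact lintegral_congr fun y => mul_left_comm _ _ _
      _ ≤ ∫⁻ x, L * ENNReal.ofReal (R ^ 2) * (F k x * w c x) := by
          refine lintegral_mono fun x => ?_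
          rw [mul_left_comm]
          gcongr
          exact hwL c x
      _ = _ := lintegral_const_mul _ ((hF k).mul (hwc c))
  have hmink : ∫⁻ y, w c y * (∑ k ∈ s, (∫⁻ x, F k x * w y x) ^ (1 / q)) ^ q ≤
      L * ENNReal.ofReal (R ^ 2) * (∑ k ∈ s, (∫⁻ x, F k x * w c x) ^ (1 / q)) ^ q := by
    have hm := lintegral_finset_sum_rpow_le (μ := volume.withDensity (w c)) s
      (f := fun k y => (∫⁻ x, F k x * w y x) ^ (1 / q)) (fun k _ => (hA k).pow_const _) hq
    rw [one_div, ENNReal.rpow_inv_le_iff hq0] at hm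
    simp only [← ENNReal.rpow_mul, inv_mul_cancel₀ hq0.ne', ENNReal.rpow_one] at hm
    rw [lintegral_withDensity_eq_lintegral_mul _ (hwc c)
      ((Finset.measurable_fun_sum s fun k _ => (hA k).pow_const _).pow_const _)] at hm
    simp only [lintegral_withDensity_eq_lintegral_mul _ (hwc c) (hA _), Pi.mul_apply] at hm
    rw [one_div]
    refine hm.trans ?_
    calc (∑ k ∈ s, (∫⁻ y, w c y * ∫⁻ x, F k x * w y x) ^ q⁻¹) ^ q
        ≤ (∑ k ∈ s, (L * ENNReal.ofReal (R ^ 2) * ∫⁻ x, F k x * w c x) ^ q⁻¹) ^ q := by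
          gcongr with k
          exact hconv k
      _ = _ := by
          simp only [ENNReal.mul_rpow_of_nonneg _ _ (inv_nonneg.2 hq0.le)]
          rw [← Finset.mul_sum, ENNReal.mul_rpow_of_nonneg _ _ hq0.le,
            ← ENNReal.mul_rpow_of_nonneg _ _ (inv_nonneg.2 hq0.le), ← ENNReal.rpow_mul,
            inv_mul_cancel₀ hq0.ne', ENNReal.rpow_one]
  have hR2 : ENNReal.ofReal (R ^ 2) ≠ 0 := by
    rw [Ne, ENNReal.ofReal_eq_zero, not_le]
    positivity
  rw [← ENNReal.mul_le_mul_iff_right hR2 ENNReal.ofReal_ne_top]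
  calc ENNReal.ofReal (R ^ 2) * ∫⁻ x, G x * w c x
      ≤ K * ∫⁻ y, w c y * ∫⁻ x in sqr y R, G x :=
        lintegral_mul_weight_le_average (hwc c) hR (hwK c) hG
    _ ≤ K * ∫⁻ y, D * (w c y * (∑ k ∈ s, (∫⁻ x, F k x * w y x) ^ (1 / q)) ^ q) := by
        refine mul_le_mul_right (lintegral_mono fun y => ?_) K
        rw [mul_left_comm]
        exact mul_le_mul_right (h y) (w c y)
    _ = K * (D * ∫⁻ y, w c y * (∑ k ∈ s, (∫⁻ x, F k x * w y x) ^ (1 / q)) ^ q) := by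
        congr 1
        exact lintegral_const_mul _ ((hwc c).mul
          ((Finset.measurable_fun_sum s fun k _ => (hA k).pow_const _).pow_const _))
    _ ≤ K * (D * (L * ENNReal.ofReal (R ^ 2) *
          (∑ k ∈ s, (∫⁻ x, F k x * w c x) ^ (1 / q)) ^ q)) := by gcongr
    _ = _ := by ring

end Averaging

section Transfer

open ENNReal

lemma integrable_norm_rpow_mul {f : ℝ × ℝ → ℂ} (hf : Continuous f) {M : ℝ} (hM : ∀ x, ‖f x‖ ≤ M)
    {p : ℝ} (hp : 0 ≤ p) {μ : Measure (ℝ × ℝ)} {w : ℝ × ℝ → ℝ} (hw : Integrable w μ) :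
    Integrable (fun x => ‖f x‖ ^ p * w x) μ := by
  refine hw.bdd_mul (c := M ^ p) ?_ (ae_of_all _ fun x => ?_)
  · exact (hf.norm.rpow_const fun _ => Or.inr hp).aestronglyMeasurable
  · rw [Real.norm_of_nonneg (by positivity)]
    exact Real.rpow_le_rpow (norm_nonneg _) (hM x) hp

lemma ofReal_wLp {f : ℝ × ℝ → ℂ} (hf : Continuous f) {M : ℝ} (hM : ∀ x, ‖f x‖ ≤ M)
    {p : ℝ} (hp : 0 < p) {w : ℝ × ℝ → ℝ} (hw : Integrable w) (hw0 : ∀ x, 0 ≤ w x) :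
    ENNReal.ofReal (wLp p w f) =
      (∫⁻ x, ENNReal.ofReal (‖f x‖ ^ p) * ENNReal.ofReal (w x)) ^ (1 / p) := by
  have hnn (x) : 0 ≤ ‖f x‖ ^ p * w x := mul_nonneg (by positivity) (hw0 x)
  rw [wLp, ← ENNReal.ofReal_rpow_of_nonneg (integral_nonneg hnn) (by positivity),
    ofReal_integral_eq_lintegral_ofReal (integrable_norm_rpow_mul hf hM hp.le hw)
      (ae_of_all _ hnn)]
  simp only [ENNReal.ofReal_mul (Real.rpow_nonneg (norm_nonneg _) p)]

lemma ofReal_sqLp {f : ℝ × ℝ → ℂ} (hf : Continuous f) {M : ℝ} (hM : ∀ x, ‖f x‖ ≤ M)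
    {p : ℝ} (hp : 0 < p) (c : ℝ × ℝ) {R : ℝ} (hR : 0 < R) :
    ENNReal.ofReal (sqLp p c R f) =
      (∫⁻ x in sqr c R, ENNReal.ofReal (‖f x‖ ^ p)) ^ (1 / p) := by
  have hnn (x) : 0 ≤ ‖f x‖ ^ p := by positivity
  have h1 : IntegrableOn (fun _ => (1 : ℝ)) (sqr c R) :=
    integrableOn_const (by rw [volume_sqr c hR]; exact ENNReal.ofReal_ne_top)
  have hint := integrable_norm_rpow_mul hf hM hp.le h1
  simp only [mul_one] at hint
  rw [sqLp, ← ENNReal.ofReal_rpow_of_nonneg (integral_nonneg hnn) (by positivity),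
    ofReal_integral_eq_lintegral_ofReal hint (ae_of_all _ hnn)]

lemma wLp_nonneg {p : ℝ} {w : ℝ × ℝ → ℝ} (hw0 : ∀ x, 0 ≤ w x) (f : ℝ × ℝ → ℂ) :
    0 ≤ wLp p w f :=
  Real.rpow_nonneg (integral_nonneg fun x => mul_nonneg (by positivity) (hw0 x)) _

lemma wLp_le_of_sqLp_le {ι : Type*} (s : Finset ι)
    {w : ℝ × ℝ → ℝ × ℝ → ℝ} (hw : Measurable (Function.uncurry w)) (hw0 : ∀ c x, 0 ≤ w c x)
    (hwi : ∀ c, Integrable (w c)) {R : ℝ} (hR : 0 < R) {K L : ℝ} (hK : 0 ≤ K) (hL : 0 ≤ L)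
    (hKL : 1 ≤ K * L)
    (hwK : ∀ c x y, x ∈ sqr y R → w c x ≤ K * w c y)
    (hwL : ∀ c x, ∫⁻ y, ENNReal.ofReal (w c y * w y x) ≤ ENNReal.ofReal (L * R ^ 2 * w c x))
    {g : ℝ × ℝ → ℂ} (hg : Continuous g) {M : ℝ} (hgM : ∀ x, ‖g x‖ ≤ M)
    {f : ι → ℝ × ℝ → ℂ} (hf : ∀ k ∈ s, Continuous (f k)) (hfM : ∀ k ∈ s, ∀ x, ‖f k x‖ ≤ M)
    {p : ℝ} (hp : 2 ≤ p) {C : ℝ} (hC : 0 ≤ C)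
    (h : ∀ y, sqLp p y R g ≤ C * (∑ k ∈ s, wLp p (w y) (f k) ^ 2) ^ (1 / 2 : ℝ)) (c : ℝ × ℝ) :
    wLp p (w c) g ≤ K * L * C * (∑ k ∈ s, wLp p (w c) (f k) ^ 2) ^ (1 / 2 : ℝ) := by
  have hp0 : 0 < p := by linarith
  set F : s → ℝ × ℝ → ℝ≥0∞ := fun k x => ENNReal.ofReal (‖f k x‖ ^ p) with hFdef
  have hF (k : s) : Measurable (F k) :=
    ENNReal.measurable_ofReal.comp ((hf k k.2).norm.rpow_const fun _ => Or.inr hp0.le).measurable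
  have hG : Measurable fun x => ENNReal.ofReal (‖g x‖ ^ p) :=
    ENNReal.measurable_ofReal.comp (hg.norm.rpow_const fun _ => Or.inr hp0.le).measurable
  have hsum (y) : ENNReal.ofReal ((∑ k ∈ s, wLp p (w y) (f k) ^ 2) ^ (1 / 2 : ℝ)) =
      (∑ k ∈ s.attach, (∫⁻ x, F k x * ENNReal.ofReal (w y x)) ^ (1 / (p / 2))) ^ (1 / 2 : ℝ) := by
    rw [← ENNReal.ofReal_rpow_of_nonneg (Finset.sum_nonneg fun k _ => sq_nonneg _) (by norm_num),
      ENNReal.ofReal_sum_of_nonneg fun k _ => sq_nonneg _, ← Finset.sum_attach]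
    congr 1
    refine Finset.sum_congr rfl fun k _ => ?_
    rw [ENNReal.ofReal_pow (wLp_nonneg (hw0 y) _), ofReal_wLp (hf k k.2) (hfM k k.2) hp0 (hwi y)
      (hw0 y), ← ENNReal.rpow_natCast, ← ENNReal.rpow_mul]
    congr 1
    push_cast
    field_simp
  have hpow (a b : ℝ≥0∞) : a ^ (1 / p) ≤ b ↔ a ≤ b ^ p := by
    rw [one_div, ENNReal.rpow_inv_le_iff hp0]
  have hhalf : (1 / 2 : ℝ) * p = p / 2 := by ring
  have key := lintegral_mul_weight_le_of_setLIntegral_sqr_le s.attach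
    (w := fun c x => ENNReal.ofReal (w c x)) (ENNReal.measurable_ofReal.comp hw) hR
    (K := ENNReal.ofReal K) (L := ENNReal.ofReal L)
    (fun c x y hxy => by
      rw [← ENNReal.ofReal_mul hK]
      exact ENNReal.ofReal_le_ofReal (hwK c x y hxy))
    (fun c x => by
      rw [← ENNReal.ofReal_mul hL, ← ENNReal.ofReal_mul (by positivity)]
      simp only [← ENNReal.ofReal_mul (hw0 c _)]
      exact hwL c x)
    hG hF (q := p / 2) (by linarith) (D := ENNReal.ofReal C ^ p)
    (fun y => by
      have hy := ENNReal.ofReal_le_ofReal (h y)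
      rwa [ofReal_sqLp hg hgM hp0 y hR, ENNReal.ofReal_mul hC, hsum, hpow,
        ENNReal.mul_rpow_of_nonneg _ _ hp0.le, ← ENNReal.rpow_mul, hhalf] at hy) c
  have hKL' : (1 : ℝ≥0∞) ≤ ENNReal.ofReal (K * L) := by
    rwa [ENNReal.one_le_ofReal]
  rw [← ENNReal.ofReal_le_ofReal_iff (by
      have := Finset.sum_nonneg fun k (_ : k ∈ s) => sq_nonneg (wLp p (w c) (f k))
      positivity),
    ofReal_wLp hg hgM hp0 (hwi c) (hw0 c), hpow, ENNReal.ofReal_mul (by positivity),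
    ENNReal.ofReal_mul (by positivity), hsum, ENNReal.mul_rpow_of_nonneg _ _ hp0.le,
    ENNReal.mul_rpow_of_nonneg _ _ hp0.le, ← ENNReal.rpow_mul, hhalf]
  refine key.trans ?_
  rw [← ENNReal.ofReal_mul hK]
  gcongr
  exact ENNReal.le_rpow_self_of_one_le hKL' (by linarith)

end Transfer

section Extension

lemma norm_extOp_integrand (g : ℝ → ℂ) (x : ℝ × ℝ) (ξ : ℝ) :
    ‖g ξ * Complex.exp (2 * Real.pi * Complex.I * ((ξ * x.1 + ξ ^ 2 * x.2 : ℝ) : ℂ))‖ = ‖g ξ‖ := by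
  have h : 2 * Real.pi * Complex.I * ((ξ * x.1 + ξ ^ 2 * x.2 : ℝ) : ℂ) =
      ((2 * Real.pi * (ξ * x.1 + ξ ^ 2 * x.2) : ℝ) : ℂ) * Complex.I := by
    push_cast
    ring
  rw [norm_mul, h, Complex.norm_exp_ofReal_mul_I, mul_one]

lemma continuous_extOp {a b : ℝ} {g : ℝ → ℂ} (hg : IntegrableOn g (Set.Icc a b)) :
    Continuous (extOp a b g) := by
  refine continuous_of_dominated (bound := fun ξ => ‖g ξ‖) (fun x => ?_)
    (fun x => ae_of_all _ fun ξ => (norm_extOp_integrand g x ξ).le) hg.norm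
    (ae_of_all _ fun ξ => by fun_prop)
  exact hg.aestronglyMeasurable.mul (Continuous.aestronglyMeasurable (by fun_prop))

lemma norm_extOp_le {a b : ℝ} {g : ℝ → ℂ} (hg : IntegrableOn g (Set.Icc 0 1))
    (hab : Set.Icc a b ⊆ Set.Icc 0 1) (x : ℝ × ℝ) :
    ‖extOp a b g x‖ ≤ ∫ ξ in Set.Icc 0 1, ‖g ξ‖ := by
  refine (norm_integral_le_integral_norm _).trans ?_
  simp only [norm_extOp_integrand]
  exact setIntegral_mono_set hg.norm (ae_of_all _ fun _ => norm_nonneg _) hab.eventuallyLE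

/-- The upgrade from squares to any weight family that is essentially constant at scale `R` and
whose self-convolution is dominated by the two-variable profile. -/
lemma wLp_extOp_le_of_sqLp_le {w : ℝ × ℝ → ℝ × ℝ → ℝ} (hw : Measurable (Function.uncurry w))
    (hw0 : ∀ c x, 0 ≤ w c x) {R : ℝ} (hR : 0 < R)
    (hwK : ∀ c x y, x ∈ sqr y R → w c x ≤ 2 ^ 200 * w c y)
    (hwφ : ∀ c x, w c x ≤ cauchyProfile R c.1 x.1 * cauchyProfile R c.2 x.2)
    (hwL : ∀ c y x, w c y * w y x ≤ 2 ^ 200 * w c x *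
      ((cauchyProfile R c.1 y.1 + cauchyProfile R x.1 y.1) *
        (cauchyProfile R c.2 y.2 + cauchyProfile R x.2 y.2)))
    {u v : ℝ} (huv : Set.Icc u v ⊆ Set.Icc 0 1) {n : ℕ} {t : ℕ → ℝ}
    (ht : ∀ k < n, Set.Icc (t k) (t (k + 1)) ⊆ Set.Icc 0 1)
    {p : ℝ} (hp : 2 ≤ p) {C : ℝ} (hC : 0 ≤ C) {g : ℝ → ℂ} (hg : IntegrableOn g (Set.Icc 0 1))
    (h : ∀ y, sqLp p y R (extOp u v g) ≤ C * (∑ k ∈ Finset.range n,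
      wLp p (w y) (extOp (t k) (t (k + 1)) g) ^ 2) ^ (1 / 2 : ℝ)) (c : ℝ × ℝ) :
    wLp p (w c) (extOp u v g) ≤ 2 ^ 200 * (2 ^ 200 * (4 * Real.pi ^ 2)) * C *
      (∑ k ∈ Finset.range n, wLp p (w c) (extOp (t k) (t (k + 1)) g) ^ 2) ^ (1 / 2 : ℝ) := by
  refine wLp_le_of_sqLp_le (Finset.range n) hw hw0 (fun c => ?_) hR (by positivity)
    (by positivity) ?_ hwK (fun c x => ?_) (continuous_extOp (hg.mono_set huv))
    (norm_extOp_le hg huv) (fun k hk => continuous_extOp (hg.mono_set (ht k (by simpa using hk))))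
    (fun k hk => norm_extOp_le hg (ht k (by simpa using hk))) hp hC h c
  · refine ((integrable_cauchyProfile hR c.1).mul_prod (integrable_cauchyProfile hR c.2)).mono'
      hw.of_uncurry_left.aestronglyMeasurable (ae_of_all _ fun x => ?_)
    rw [Real.norm_of_nonneg (hw0 c x)]
    exact hwφ c x
  · nlinarith [Real.pi_gt_three]
  · calc ∫⁻ y, ENNReal.ofReal (w c y * w y x)
        ≤ ∫⁻ y : ℝ × ℝ, ENNReal.ofReal (2 ^ 200 * w c x *
            ((cauchyProfile R c.1 y.1 + cauchyProfile R x.1 y.1) *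
              (cauchyProfile R c.2 y.2 + cauchyProfile R x.2 y.2))) :=
          lintegral_mono fun y => ENNReal.ofReal_le_ofReal (hwL c y x)
      _ = ENNReal.ofReal (∫ y : ℝ × ℝ, 2 ^ 200 * w c x *
            ((cauchyProfile R c.1 y.1 + cauchyProfile R x.1 y.1) *
              (cauchyProfile R c.2 y.2 + cauchyProfile R x.2 y.2))) :=
          (ofReal_integral_eq_lintegral_ofReal
            ((integrable_cauchyProfile_prod hR c x).const_mul _)
            (ae_of_all _ fun y => (mul_nonneg (hw0 c y) (hw0 y x)).trans (hwL c y x))).symm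
      _ = ENNReal.ofReal (2 ^ 200 * (4 * Real.pi ^ 2) * R ^ 2 * w c x) := by
          rw [integral_const_mul, integral_cauchyProfile_prod hR]
          ring_nf

end Extension

/-- an unweighted decoupling inequality for `E_I` with respect to a partition of
the interval `I = [u,v] ⊆ [0,1]` upgrades to a weighted one, with an absolute constant loss;
the same holds for the product weights `w̃`. -/
theorem unweighted_to_weighted_decoupling :
    ∃ c : ℝ, 0 < c ∧
      ∀ (u v : ℝ) (n : ℕ) (t : ℕ → ℝ), 0 ≤ u → u ≤ v → v ≤ 1 →
        t 0 = u → t n = v → (∀ k < n, t k ≤ t (k + 1)) →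
        ∀ p : ℝ, 2 ≤ p → ∀ R : ℝ, 0 < R → ∀ C₀ : ℝ, 0 ≤ C₀ →
        ((∀ g : ℝ → ℂ, IntegrableOn g (Set.Icc 0 1) → ∀ cB : ℝ × ℝ,
            sqLp p cB R (extOp u v g) ≤
              C₀ * (∑ k ∈ Finset.range n,
                wLp p (wB cB R) (extOp (t k) (t (k + 1)) g) ^ 2) ^ (1 / 2 : ℝ)) →
          ∀ g : ℝ → ℂ, IntegrableOn g (Set.Icc 0 1) → ∀ cB : ℝ × ℝ,
            wLp p (wB cB R) (extOp u v g) ≤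
              c * C₀ * (∑ k ∈ Finset.range n,
                wLp p (wB cB R) (extOp (t k) (t (k + 1)) g) ^ 2) ^ (1 / 2 : ℝ)) ∧
        ((∀ g : ℝ → ℂ, IntegrableOn g (Set.Icc 0 1) → ∀ cB : ℝ × ℝ,
            sqLp p cB R (extOp u v g) ≤
              C₀ * (∑ k ∈ Finset.range n,
                wLp p (wtB cB R) (extOp (t k) (t (k + 1)) g) ^ 2) ^ (1 / 2 : ℝ)) →
          ∀ g : ℝ → ℂ, IntegrableOn g (Set.Icc 0 1) → ∀ cB : ℝ × ℝ,
            wLp p (wtB cB R) (extOp u v g) ≤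
              c * C₀ * (∑ k ∈ Finset.range n,
                wLp p (wtB cB R) (extOp (t k) (t (k + 1)) g) ^ 2) ^ (1 / 2 : ℝ)) := by
  refine ⟨2 ^ 200 * (2 ^ 200 * (4 * Real.pi ^ 2)), by positivity, ?_⟩
  intro u v n t hu _ hv ht0 htn ht p hp R hR C₀ hC₀
  have hlow : ∀ k ≤ n, u ≤ t k := by
    intro k hk
    induction k with
    | zero => exact ht0.ge
    | succ k ih => exact (ih (by omega)).trans (ht k (by omega))
  have hupp : ∀ k ≤ n, t k ≤ v := by
    intro k hk
    induction hk using Nat.decreasingInduction with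
    | self => exact htn.le
    | of_succ k hk ih => exact (ht k hk).trans ih
  have huv : Set.Icc u v ⊆ Set.Icc 0 1 := Set.Icc_subset_Icc hu hv
  have hsub : ∀ k < n, Set.Icc (t k) (t (k + 1)) ⊆ Set.Icc 0 1 := fun k hk =>
    Set.Icc_subset_Icc (hu.trans (hlow k hk.le)) ((hupp (k + 1) hk).trans hv)
  exact ⟨fun h g hg => wLp_extOp_le_of_sqLp_le (w := fun c => wB c R) (measurable_wB R)
      (wB_nonneg hR) hR (fun _ _ _ => wB_le_of_mem_sqr hR) (wB_le_cauchyProfile hR)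
      (wB_mul_wB_le hR) huv hsub hp hC₀ hg (h g hg),
    fun h g hg => wLp_extOp_le_of_sqLp_le (w := fun c => wtB c R) (measurable_wtB R)
      (wtB_nonneg hR) hR (fun _ _ _ => wtB_le_of_mem_sqr hR) (wtB_le_cauchyProfile hR)
      (wtB_mul_wtB_le hR) huv hsub hp hC₀ hg (h g hg)⟩
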